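/- The map Ψ_sh(v) := 2∂ₓ⁻¹v + c_sh(v) is a bijection from the set {v: ℝ → ℝ continuous, 1-periodic, ∫₀¹ v = 0} onto the set {u: ℝ → ℝ continuously differentiable, 1-periodic, ∫₀¹ sinh(u(x)) dx = 0}, and its inverse is given by u ↦ u′/2. -/

import Mathlib

open MeasureTheory Real intervalIntegral

/-- Inverse hyperbolic tangent on (-1,1). -/
noncomputable def artanh (x : ℝ) : ℝ := (1 / 2) * Real.log ((1 + x) / (1 - x))

/-- The mean-zero antiderivative of a (continuous, 1-periodic, mean-zero) function:
`(∂ₓ⁻¹ f)(x) = ∫₀ˣ f(s) ds − ∫₀¹ ∫₀ʸ f(s) ds dy`. -/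
noncomputable def pInv (f : ℝ → ℝ) (x : ℝ) : ℝ :=
  (∫ s in (0:ℝ)..x, f s) - ∫ y in (0:ℝ)..1, ∫ s in (0:ℝ)..y, f s

/-- `c_sh(v) = - artanh ((∫₀¹ sinh (2 ∂ₓ⁻¹v)) / (∫₀¹ cosh (2 ∂ₓ⁻¹v)))`. -/
noncomputable def cSh (v : ℝ → ℝ) : ℝ :=
  - _root_.artanh ((∫ x in (0:ℝ)..1, Real.sinh (2 * pInv v x)) /
      (∫ x in (0:ℝ)..1, Real.cosh (2 * pInv v x)))

/-- The map `Ψ_sh(v) = 2 ∂ₓ⁻¹ v + c_sh(v)`. -/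
noncomputable def PsiSh (v : ℝ → ℝ) : ℝ → ℝ := fun x => 2 * pInv v x + cSh v

theorem artanh_eq_real_artanh {x : ℝ} (hx : x ∈ Set.Ioo (-1) 1) :
    _root_.artanh x = Real.artanh x :=
  (Real.artanh_eq_half_log (Set.Ioo_subset_Icc_self hx)).symm

/-- The mean of `sinh ∘ g` is strictly smaller in absolute value than that of `cosh ∘ g`. -/
theorem integral_cosh_pos_and_sinh_div_cosh_mem_Ioo {g : ℝ → ℝ} (hg : Continuous g) :
    0 < (∫ x in (0:ℝ)..1, Real.cosh (g x)) ∧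
    (∫ x in (0:ℝ)..1, Real.sinh (g x)) / (∫ x in (0:ℝ)..1, Real.cosh (g x)) ∈
      Set.Ioo (-1 : ℝ) 1 := by
  have hs : IntervalIntegrable (fun x => Real.sinh (g x)) volume 0 1 :=
    (by fun_prop : Continuous fun x => Real.sinh (g x)).intervalIntegrable _ _
  have hc : IntervalIntegrable (fun x => Real.cosh (g x)) volume 0 1 :=
    (by fun_prop : Continuous fun x => Real.cosh (g x)).intervalIntegrable _ _
  have hadd : 0 < ∫ x in (0:ℝ)..1, (Real.cosh (g x) + Real.sinh (g x)) :=
    intervalIntegral_pos_of_pos (hc.add hs)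
      (fun x => by rw [Real.cosh_add_sinh]; positivity) one_pos
  have hsub : 0 < ∫ x in (0:ℝ)..1, (Real.cosh (g x) - Real.sinh (g x)) :=
    intervalIntegral_pos_of_pos (hc.sub hs)
      (fun x => by rw [Real.cosh_sub_sinh]; positivity) one_pos
  rw [intervalIntegral.integral_add hc hs] at hadd
  rw [intervalIntegral.integral_sub hc hs] at hsub
  have hpos : 0 < ∫ x in (0:ℝ)..1, Real.cosh (g x) := by linarith
  refine ⟨hpos, ?_, ?_⟩
  · rw [lt_div_iff₀ hpos]; linarith
  · rw [div_lt_iff₀ hpos]; linarith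

/-- The unique constant shift of `g` that makes the mean of `sinh` vanish. -/
theorem integral_sinh_add_const_eq_zero_iff {g : ℝ → ℝ} (hg : Continuous g) (c : ℝ) :
    (∫ x in (0:ℝ)..1, Real.sinh (g x + c)) = 0 ↔
      -_root_.artanh ((∫ x in (0:ℝ)..1, Real.sinh (g x)) /
        (∫ x in (0:ℝ)..1, Real.cosh (g x))) = c := by
  obtain ⟨hpos, hmem⟩ := integral_cosh_pos_and_sinh_div_cosh_mem_Ioo hg
  have hs : IntervalIntegrable (fun x => Real.sinh (g x) * Real.cosh c) volume 0 1 :=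
    (by fun_prop : Continuous fun x => Real.sinh (g x) * Real.cosh c).intervalIntegrable _ _
  have hc : IntervalIntegrable (fun x => Real.cosh (g x) * Real.sinh c) volume 0 1 :=
    (by fun_prop : Continuous fun x => Real.cosh (g x) * Real.sinh c).intervalIntegrable _ _
  rw [artanh_eq_real_artanh hmem]
  simp only [Real.sinh_add]
  rw [intervalIntegral.integral_add hs hc, intervalIntegral.integral_mul_const,
    intervalIntegral.integral_mul_const]
  have htanh : -Real.artanh ((∫ x in (0:ℝ)..1, Real.sinh (g x)) /
        (∫ x in (0:ℝ)..1, Real.cosh (g x))) = c ↔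
      (∫ x in (0:ℝ)..1, Real.sinh (g x)) / (∫ x in (0:ℝ)..1, Real.cosh (g x)) =
        Real.tanh (-c) := by
    constructor
    · rintro rfl
      rw [neg_neg, Real.tanh_artanh hmem]
    · intro h
      rw [h, Real.artanh_tanh, neg_neg]
  rw [htanh, Real.tanh_neg, Real.tanh_eq_sinh_div_cosh, ← neg_div,
    div_eq_div_iff hpos.ne' (Real.cosh_pos c).ne']
  constructor <;> intro h <;> linarith

theorem hasDerivAt_pInv {v : ℝ → ℝ} (hv : Continuous v) (x : ℝ) :
    HasDerivAt (pInv v) (v x) x :=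
  (hv.integral_hasStrictDerivAt 0 x).hasDerivAt.sub_const _

theorem continuous_pInv {v : ℝ → ℝ} (hv : Continuous v) : Continuous (pInv v) :=
  continuous_iff_continuousAt.2 fun x => (hasDerivAt_pInv hv x).continuousAt

theorem periodic_pInv {v : ℝ → ℝ} (hv : Continuous v) (hp : Function.Periodic v 1)
    (h0 : (∫ x in (0:ℝ)..1, v x) = 0) : Function.Periodic (pInv v) 1 := by
  intro x
  have hshift := hp.intervalIntegral_add_eq x 0
  rw [zero_add, h0] at hshift
  have hsplit := intervalIntegral.integral_add_adjacent_intervals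
    (hv.intervalIntegrable (μ := volume) 0 x) (hv.intervalIntegrable x (x + 1))
  simp only [pInv]
  linarith

theorem hasDerivAt_PsiSh {v : ℝ → ℝ} (hv : Continuous v) (x : ℝ) :
    HasDerivAt (PsiSh v) (2 * v x) x :=
  ((hasDerivAt_pInv hv x).const_mul 2).add_const _

theorem deriv_PsiSh {v : ℝ → ℝ} (hv : Continuous v) : deriv (PsiSh v) = fun x => 2 * v x :=
  funext fun x => (hasDerivAt_PsiSh hv x).deriv

theorem two_mul_pInv_half_deriv {u : ℝ → ℝ} (hu : ContDiff ℝ 1 u) (x : ℝ) :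
    2 * pInv (fun y => deriv u y / 2) x = u x - ∫ y in (0:ℝ)..1, u y := by
  have hftc (y : ℝ) : (∫ s in (0:ℝ)..y, deriv u s / 2) = (u y - u 0) / 2 := by
    rw [intervalIntegral.integral_div, intervalIntegral.integral_deriv_eq_sub
      (fun z _ => hu.differentiable one_ne_zero z)
      ((hu.continuous_deriv le_rfl).intervalIntegrable _ _)]
  simp only [pInv, hftc]
  rw [intervalIntegral.integral_div, intervalIntegral.integral_sub
    (hu.continuous.intervalIntegrable _ _) (by simp), intervalIntegral.integral_const]
  simp only [sub_zero, one_smul]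
  ring

theorem PsiSh_mem {v : ℝ → ℝ} (hv : Continuous v) (hp : Function.Periodic v 1)
    (h0 : (∫ x in (0:ℝ)..1, v x) = 0) :
    ContDiff ℝ 1 (PsiSh v) ∧ Function.Periodic (PsiSh v) 1 ∧
      (∫ x in (0:ℝ)..1, Real.sinh (PsiSh v x)) = 0 := by
  refine ⟨contDiff_one_iff_deriv.2 ⟨fun x => (hasDerivAt_PsiSh hv x).differentiableAt, ?_⟩,
    fun x => ?_, ?_⟩
  · rw [deriv_PsiSh hv]
    fun_prop
  · simp only [PsiSh, periodic_pInv hv hp h0 x]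
  · exact (integral_sinh_add_const_eq_zero_iff
      ((continuous_pInv hv).const_mul 2) (cSh v)).2 rfl

theorem half_deriv_mem {u : ℝ → ℝ} (hu : ContDiff ℝ 1 u) (hp : Function.Periodic u 1) :
    Continuous (fun x => deriv u x / 2) ∧ Function.Periodic (fun x => deriv u x / 2) 1 ∧
      (∫ x in (0:ℝ)..1, deriv u x / 2) = 0 := by
  refine ⟨(hu.continuous_deriv le_rfl).div_const 2, fun x => ?_, ?_⟩
  · simp only [← deriv_comp_add_const, show (fun y => u (y + 1)) = u from funext hp]
  · rw [intervalIntegral.integral_div, intervalIntegral.integral_deriv_eq_sub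
      (fun z _ => hu.differentiable one_ne_zero z)
      ((hu.continuous_deriv le_rfl).intervalIntegrable _ _), ← zero_add (1 : ℝ), hp 0]
    simp

theorem half_deriv_PsiSh {v : ℝ → ℝ} (hv : Continuous v) :
    (fun x => deriv (PsiSh v) x / 2) = v := by
  funext x
  rw [deriv_PsiSh hv]
  ring

theorem PsiSh_half_deriv {u : ℝ → ℝ} (hu : ContDiff ℝ 1 u)
    (h0 : (∫ x in (0:ℝ)..1, Real.sinh (u x)) = 0) :
    PsiSh (fun x => deriv u x / 2) = u := by
  have hc : cSh (fun x => deriv u x / 2) = ∫ y in (0:ℝ)..1, u y := by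
    simp only [cSh, two_mul_pInv_half_deriv hu]
    refine (integral_sinh_add_const_eq_zero_iff (hu.continuous.sub continuous_const) _).1 ?_
    simpa using h0
  funext x
  simp only [PsiSh, hc, two_mul_pInv_half_deriv hu, sub_add_cancel]

/-- `Ψ_sh` is a bijection from continuous 1-periodic mean-zero functions onto
C¹ 1-periodic functions `u` with `∫₀¹ sinh (u x) dx = 0`, with inverse `u ↦ u'/2`. -/
theorem psiSh_bijective :
    Set.BijOn PsiSh
      {v : ℝ → ℝ | Continuous v ∧ Function.Periodic v 1 ∧ (∫ x in (0:ℝ)..1, v x) = 0}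
      {u : ℝ → ℝ | ContDiff ℝ 1 u ∧ Function.Periodic u 1 ∧
        (∫ x in (0:ℝ)..1, Real.sinh (u x)) = 0} ∧
    (∀ v ∈ {v : ℝ → ℝ | Continuous v ∧ Function.Periodic v 1 ∧ (∫ x in (0:ℝ)..1, v x) = 0},
      (fun x => deriv (PsiSh v) x / 2) = v) ∧
    (∀ u ∈ {u : ℝ → ℝ | ContDiff ℝ 1 u ∧ Function.Periodic u 1 ∧
        (∫ x in (0:ℝ)..1, Real.sinh (u x)) = 0},
      PsiSh (fun x => deriv u x / 2) = u) := by
  refine ⟨Set.BijOn.mk (fun v hv => PsiSh_mem hv.1 hv.2.1 hv.2.2) ?_ ?_,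
    fun v hv => half_deriv_PsiSh hv.1, fun u hu => PsiSh_half_deriv hu.1 hu.2.2⟩
  · intro v hv w hw h
    rw [← half_deriv_PsiSh hv.1, h, half_deriv_PsiSh hw.1]
  · exact fun u hu => ⟨_, half_deriv_mem hu.1 hu.2.1, PsiSh_half_deriv hu.1 hu.2.2⟩
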